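/- Let Σ_Λ = {Σ_λ = (γ_λ,f_λ,g_λ)}_{λ∈Λ} be a parametrized family of impulsive systems with inputs, let h⁰, h ∈ H, and let Assumption 1 hold. If the parametrized family of comparison systems is strongly GUAS, then Σ_Λ is strongly (h⁰,h)-ISS. -/

import Mathlib

open MeasureTheory Filter Set
open scoped Classical

noncomputable section

/-- State/input spaces: `ℝ^k` with the Euclidean norm. -/
abbrev Stt (k : ℕ) : Type := EuclideanSpace ℝ (Fin k)

/-- An impulse-time sequence, identified with its (locally finite) set of impulse
times, a subset of `(0,∞)` with finitely many points below any bound. -/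
def IsImpulseSeq (γ : Set ℝ) : Prop :=
  γ ⊆ Set.Ioi (0 : ℝ) ∧ ∀ T : ℝ, (γ ∩ Set.Iic T).Finite

/-- `n^γ_{(s,t]}`: the number of impulse times in the interval `(s,t]`. -/
def nJumps (γ : Set ℝ) (s t : ℝ) : ℕ := (γ ∩ Set.Ioc s t).ncard

/-- Uniform incremental boundedness of a set of impulse-time sequences. -/
def UIB (S : Set (Set ℝ)) : Prop :=
  ∃ φ : ℝ → ℝ, ContinuousOn φ (Set.Ici 0) ∧ MonotoneOn φ (Set.Ici 0) ∧
    (∀ s : ℝ, 0 ≤ s → 0 ≤ φ s) ∧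
    ∀ γ ∈ S, ∀ t0 t : ℝ, 0 ≤ t0 → t0 < t → (nJumps γ t0 t : ℝ) ≤ φ (t - t0)

/-- Class `K∞` functions `[0,∞) → [0,∞)`. -/
def ClassKInf (α : ℝ → ℝ) : Prop :=
  ContinuousOn α (Set.Ici 0) ∧ StrictMonoOn α (Set.Ici 0) ∧ α 0 = 0 ∧
    ∀ M : ℝ, ∃ r : ℝ, 0 ≤ r ∧ M ≤ α r

/-- Class `KL` functions. -/
def ClassKL (β : ℝ → ℝ → ℝ) : Prop :=
  (∀ t : ℝ, 0 ≤ t → ClassKInf fun r => β r t) ∧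
  ∀ r : ℝ, 0 ≤ r → AntitoneOn (fun t => β r t) (Set.Ici 0) ∧
    Filter.Tendsto (fun t => β r t) Filter.atTop (nhds 0)

/-- Positive definite functions `[0,∞) → [0,∞)`. -/
def PosDef (ρ : ℝ → ℝ) : Prop :=
  ContinuousOn ρ (Set.Ici 0) ∧ ρ 0 = 0 ∧ ∀ r : ℝ, 0 < r → 0 < ρ r

/-- Locally integrable (on compacts) function `[0,∞) → ℝ` (extended to `ℝ`). -/
def LocIntegrable (p : ℝ → ℝ) : Prop :=
  ∀ a b : ℝ, MeasureTheory.IntegrableOn p (Set.Icc a b)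

/-- Inputs: measurable, locally essentially bounded functions. -/
def IsInput {m : ℕ} (u : ℝ → Stt m) : Prop :=
  Measurable u ∧ ∀ T : ℝ, ∃ C : ℝ, ∀ᵐ t ∂MeasureTheory.volume, t ∈ Set.Icc 0 T → ‖u t‖ ≤ C

/-- `‖u_I‖_γ`: max of the essential supremum of `‖u‖` over `I` and the supremum of
`‖u‖` over `γ ∩ I`. -/
def inputNorm {m : ℕ} (γ : Set ℝ) (u : ℝ → Stt m) (I : Set ℝ) : ℝ :=
  max (essSup (fun t => ‖u t‖) (MeasureTheory.volume.restrict I))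
      (sSup ((fun t => ‖u t‖) '' (γ ∩ I)))

/-- Solution of the impulsive system `(γ,f,g)` on `[t0,T)` with initial state `x0`
and input `u` (Carathéodory solutions, in integral form, between impulses). -/
structure IsSolution {n m : ℕ} (γ : Set ℝ) (f g : ℝ → Stt n → Stt m → Stt n)
    (t0 : ℝ) (x0 : Stt n) (u : ℝ → Stt m) (T : EReal) (x : ℝ → Stt n) : Prop where
  lt : (t0 : EReal) < T
  init : x t0 = x0
  flow : ∀ t1 t2 : ℝ, t0 ≤ t1 → t1 ≤ t2 → (t2 : EReal) < T → Set.Ioc t1 t2 ∩ γ = ∅ →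
    MeasureTheory.IntegrableOn (fun s => f s (x s) (u s)) (Set.Icc t1 t2) ∧
    x t2 = x t1 + ∫ s in t1..t2, f s (x s) (u s)
  jump : ∀ t ∈ γ, t0 < t → (t : EReal) < T →
    ∃ L : Stt n, Filter.Tendsto x (nhdsWithin t (Set.Iio t)) (nhds L) ∧
      x t = L + g t L (u t)

/-- Maximally defined solution. -/
def IsMaxSolution {n m : ℕ} (γ : Set ℝ) (f g : ℝ → Stt n → Stt m → Stt n)
    (t0 : ℝ) (x0 : Stt n) (u : ℝ → Stt m) (T : EReal) (x : ℝ → Stt n) : Prop :=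
  IsSolution γ f g t0 x0 u T x ∧
    ∀ (T' : EReal) (x' : ℝ → Stt n), IsSolution γ f g t0 x0 u T' x' →
      (∀ t : ℝ, t0 ≤ t → (t : EReal) < T → x' t = x t) → T' ≤ T

/-- Weak `(h⁰,h)`-ISS of a parametrized family of impulsive systems. -/
def WeaklyISS {n m : ℕ} {Λ : Type*} (γ : Λ → Set ℝ)
    (f g : Λ → ℝ → Stt n → Stt m → Stt n) (h0 h : ℝ → Stt n → ℝ) : Prop :=
  ∃ β : ℝ → ℝ → ℝ, ∃ ρ : ℝ → ℝ, ClassKL β ∧ ClassKInf ρ ∧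
    ∀ (l : Λ) (t0 : ℝ) (x0 : Stt n) (u : ℝ → Stt m) (T : EReal) (x : ℝ → Stt n),
      0 ≤ t0 → IsInput u → IsMaxSolution (γ l) (f l) (g l) t0 x0 u T x →
      ∀ t : ℝ, t0 ≤ t → (t : EReal) < T →
        h t (x t) ≤ β (h0 t0 x0) (t - t0) + ρ (inputNorm (γ l) u (Set.Ioc t0 t))

/-- Strong `(h⁰,h)`-ISS of a parametrized family of impulsive systems. -/
def StronglyISS {n m : ℕ} {Λ : Type*} (γ : Λ → Set ℝ)
    (f g : Λ → ℝ → Stt n → Stt m → Stt n) (h0 h : ℝ → Stt n → ℝ) : Prop :=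
  ∃ β : ℝ → ℝ → ℝ, ∃ ρ : ℝ → ℝ, ClassKL β ∧ ClassKInf ρ ∧
    ∀ (l : Λ) (t0 : ℝ) (x0 : Stt n) (u : ℝ → Stt m) (T : EReal) (x : ℝ → Stt n),
      0 ≤ t0 → IsInput u → IsMaxSolution (γ l) (f l) (g l) t0 x0 u T x →
      ∀ t : ℝ, t0 ≤ t → (t : EReal) < T →
        h t (x t) ≤ β (h0 t0 x0) (t - t0 + (nJumps (γ l) t0 t : ℝ)) +
          ρ (inputNorm (γ l) u (Set.Ioc t0 t))

/-- Locally Lipschitz on a set. -/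
def LocLipschitzOn {α β : Type*} [PseudoEMetricSpace α] [PseudoEMetricSpace β]
    (s : Set α) (f : α → β) : Prop :=
  ∀ x ∈ s, ∃ K : NNReal, ∃ t ∈ nhdsWithin x s, LipschitzOnWith K f t

/-- `V ∈ V(γ)` with `Vm` its left-limit function at impulse times: `V` is locally
Lipschitz on each inter-impulse strip and has the joint left limit `Vm τ ξ`
at each `τ ∈ γ`. -/
def InClassV {n : ℕ} (γ : Set ℝ) (V Vm : ℝ → Stt n → ℝ) : Prop :=
  (∀ a b : ℝ, 0 ≤ a → Set.Ioo a b ∩ γ = ∅ →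
    LocLipschitzOn (Set.Ico a b ×ˢ (Set.univ : Set (Stt n)))
      (fun q : ℝ × Stt n => V q.1 q.2)) ∧
  ∀ τ ∈ γ, ∀ ξ : Stt n,
    Filter.Tendsto (fun q : ℝ × Stt n => V q.1 q.2)
      (nhdsWithin (τ, ξ) (Set.Iio τ ×ˢ (Set.univ : Set (Stt n)))) (nhds (Vm τ ξ))

/-- Upper-right Dini derivative of `V` along the flow map `f`. -/
def DiniAlong {n m : ℕ} (f : ℝ → Stt n → Stt m → Stt n) (V : ℝ → Stt n → ℝ)
    (t : ℝ) (ξ : Stt n) (μ : Stt m) : ℝ :=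
  Filter.limsup (fun d : ℝ => (V (t + d) (ξ + d • f t ξ μ) - V t ξ) / d)
    (nhdsWithin 0 (Set.Ioi 0))

/-- Carathéodory function `[0,∞) × [0,∞) → ℝ`. -/
def Caratheodory2 (φ : ℝ → ℝ → ℝ) : Prop :=
  (∀ r : ℝ, Measurable fun t => φ t r) ∧
  (∀ t : ℝ, ContinuousOn (φ t) (Set.Ici 0)) ∧
  ∀ a b c : ℝ, ∃ mK : ℝ → ℝ, MeasureTheory.IntegrableOn mK (Set.Icc a b) ∧
    ∀ t ∈ Set.Icc a b, ∀ r ∈ Set.Icc (0 : ℝ) c, |φ t r| ≤ mK t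

/-- Assumption 1 of the paper, with all the data explicit. -/
def Assumption1 {n m : ℕ} {Λ : Type*} (γ : Λ → Set ℝ)
    (f g : Λ → ℝ → Stt n → Stt m → Stt n) (h0 h : ℝ → Stt n → ℝ)
    (V Vm : Λ → ℝ → Stt n → ℝ) (φ1 φ2 χ π : ℝ → ℝ)
    (vφ al : Λ → ℝ → ℝ → ℝ) : Prop :=
  ClassKInf φ1 ∧ ClassKInf φ2 ∧ ClassKInf χ ∧ ClassKInf π ∧
  (∀ l : Λ, InClassV (γ l) (V l) (Vm l)) ∧
  (∀ l : Λ, Caratheodory2 (vφ l)) ∧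
  (∀ (l : Λ) (t r : ℝ), 0 ≤ t → 0 ≤ r → 0 ≤ al l t r) ∧
  (∀ (l : Λ) (t : ℝ) (ξ : Stt n), 0 ≤ t →
    φ1 (h t ξ) ≤ V l t ξ ∧ V l t ξ ≤ φ2 (h0 t ξ)) ∧
  (∀ (l : Λ) (t : ℝ) (ξ : Stt n) (μ : Stt m), 0 ≤ t → t ∉ γ l → χ ‖μ‖ ≤ V l t ξ →
    DiniAlong (f l) (V l) t ξ μ ≤ - vφ l t (V l t ξ)) ∧
  (∀ (l : Λ) (t : ℝ) (ξ : Stt n) (μ : Stt m), t ∈ γ l → χ ‖μ‖ ≤ Vm l t ξ →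
    V l t (ξ + g l t ξ μ) ≤ al l t (Vm l t ξ)) ∧
  (∀ (l : Λ) (t : ℝ) (ξ : Stt n) (μ : Stt m), t ∈ γ l → Vm l t ξ ≤ χ ‖μ‖ →
    V l t (ξ + g l t ξ μ) ≤ π ‖μ‖)

/-- Solution of the scalar comparison differential/difference inclusion. -/
structure IsCompSol (γ : Set ℝ) (vφ al : ℝ → ℝ → ℝ) (t0 z0 : ℝ) (T : EReal)
    (z : ℝ → ℝ) : Prop where
  lt : (t0 : EReal) < T
  init : z t0 = z0
  nonneg : ∀ t : ℝ, t0 ≤ t → (t : EReal) < T → 0 ≤ z t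
  flow : ∀ t1 t2 : ℝ, t0 ≤ t1 → t1 ≤ t2 → (t2 : EReal) < T → Set.Ioc t1 t2 ∩ γ = ∅ →
    ∃ d : ℝ → ℝ, MeasureTheory.IntegrableOn d (Set.Icc t1 t2) ∧
      (∀ᵐ s ∂MeasureTheory.volume, s ∈ Set.Icc t1 t2 → d s ≤ - vφ s (z s)) ∧
      ∀ t ∈ Set.Icc t1 t2, z t = z t1 + ∫ s in t1..t, d s
  jump : ∀ t ∈ γ, t0 < t → (t : EReal) < T →
    ∃ L : ℝ, Filter.Tendsto z (nhdsWithin t (Set.Iio t)) (nhds L) ∧ z t ≤ al t L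

/-- The family of comparison systems is weakly GUAS. -/
def CompWeakGUAS {Λ : Type*} (γ : Λ → Set ℝ) (vφ al : Λ → ℝ → ℝ → ℝ) : Prop :=
  ∃ β : ℝ → ℝ → ℝ, ClassKL β ∧
    ∀ (l : Λ) (t0 z0 : ℝ) (T : EReal) (z : ℝ → ℝ), 0 ≤ t0 → 0 ≤ z0 →
      IsCompSol (γ l) (vφ l) (al l) t0 z0 T z →
      ∀ t : ℝ, t0 ≤ t → (t : EReal) < T → z t ≤ β z0 (t - t0)

/-- The family of comparison systems is strongly GUAS. -/
def CompStrongGUAS {Λ : Type*} (γ : Λ → Set ℝ) (vφ al : Λ → ℝ → ℝ → ℝ) : Prop :=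
  ∃ β : ℝ → ℝ → ℝ, ClassKL β ∧
    ∀ (l : Λ) (t0 z0 : ℝ) (T : EReal) (z : ℝ → ℝ), 0 ≤ t0 → 0 ≤ z0 →
      IsCompSol (γ l) (vφ l) (al l) t0 z0 T z →
      ∀ t : ℝ, t0 ≤ t → (t : EReal) < T → z t ≤ β z0 (t - t0 + (nJumps (γ l) t0 t : ℝ))

/-- Nonnegative Carathéodory solution of the scalar ODE `ẇ = rhs(t,w)` on `[t0,T)`. -/
structure IsODESol (rhs : ℝ → ℝ → ℝ) (t0 : ℝ) (T : EReal) (w : ℝ → ℝ) : Prop where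
  lt : (t0 : EReal) < T
  nonneg : ∀ t : ℝ, t0 ≤ t → (t : EReal) < T → 0 ≤ w t
  flow : ∀ t1 t2 : ℝ, t0 ≤ t1 → t1 ≤ t2 → (t2 : EReal) < T →
    IntervalIntegrable (fun s => rhs s (w s)) MeasureTheory.volume t1 t2 ∧
    w t2 = w t1 + ∫ s in t1..t2, rhs s (w s)

/-- Maximally defined forward-in-time solution of `ẇ = rhs(t,w)`. -/
def IsMaxODESol (rhs : ℝ → ℝ → ℝ) (t0 : ℝ) (T : EReal) (w : ℝ → ℝ) : Prop :=
  IsODESol rhs t0 T w ∧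
    ∀ (T' : EReal) (w' : ℝ → ℝ), IsODESol rhs t0 T' w' →
      (∀ t : ℝ, t0 ≤ t → (t : EReal) < T → w' t = w t) → T' ≤ T

/-- GUAS of the family of scalar ODEs `ẇ = −φ_λ(t,w)`. -/
def ODEFamilyGUAS {Λ : Type*} (vφ : Λ → ℝ → ℝ → ℝ) : Prop :=
  ∃ β : ℝ → ℝ → ℝ, ClassKL β ∧
    ∀ (l : Λ) (t0 : ℝ) (T : EReal) (w : ℝ → ℝ), 0 ≤ t0 →
      IsMaxODESol (fun s r => -(vφ l s r)) t0 T w →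
      T = (⊤ : EReal) ∧ ∀ t : ℝ, t0 ≤ t → w t ≤ β (w t0) (t - t0)

/-- Solution (on all of `[0,∞)`) of the scalar linear ODE `ẇ = −p(t)·w`. -/
def IsLinSol (p : ℝ → ℝ) (w : ℝ → ℝ) : Prop :=
  ∀ t1 t2 : ℝ, 0 ≤ t1 → t1 ≤ t2 →
    IntervalIntegrable (fun s => p s * w s) MeasureTheory.volume t1 t2 ∧
    w t2 = w t1 + ∫ s in t1..t2, -(p s * w s)

/-- An impulsive and switching sequence, described through its impulse-time set,
its two switching signals (constant between impulses), and the left limit of the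
first switching signal at impulse times. -/
structure SwSignal (Ic Id : Type*) where
  γ : Set ℝ
  σ1 : ℝ → Ic
  σ1m : ℝ → Ic
  σ2 : ℝ → Id
  impulse : IsImpulseSeq γ
  const1 : ∀ a b : ℝ, 0 ≤ a → Set.Ioo a b ∩ γ = ∅ → ∀ t ∈ Set.Ico a b, σ1 t = σ1 a
  const2 : ∀ a b : ℝ, 0 ≤ a → Set.Ioo a b ∩ γ = ∅ → ∀ t ∈ Set.Ico a b, σ2 t = σ2 a
  leftlim : ∀ t ∈ γ, ∀ᶠ s in nhdsWithin t (Set.Iio t), σ1 s = σ1m t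

/-- `σ ∈ SW(J)`. -/
def InSW {Ic Id : Type*} (σ : SwSignal Ic Id) (J : Set (Ic × Ic × Id)) : Prop :=
  ∀ t ∈ σ.γ, (σ.σ1m t, σ.σ1 t, σ.σ2 t) ∈ J

/-- Flow map of the switched impulsive system `Σ_σ`. -/
def swF {n m : ℕ} {Ic Id : Type*} (F : Ic → ℝ → Stt n → Stt m → Stt n)
    (σ : SwSignal Ic Id) : ℝ → Stt n → Stt m → Stt n :=
  fun t ξ μ => F (σ.σ1 t) t ξ μ

/-- Jump map of the switched impulsive system `Σ_σ`. -/
def swG {n m : ℕ} {Ic Id : Type*} (G : Id → ℝ → Stt n → Stt m → Stt n)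
    (σ : SwSignal Ic Id) : ℝ → Stt n → Stt m → Stt n :=
  fun t ξ μ => G (σ.σ2 t) t ξ μ

/-- Weak `(h⁰,h)`-ISS of the family `{Σ_σ}_{σ ∈ SW}`. -/
def SwWeaklyISS {n m : ℕ} {Ic Id : Type*} (F : Ic → ℝ → Stt n → Stt m → Stt n)
    (G : Id → ℝ → Stt n → Stt m → Stt n) (SW : Set (SwSignal Ic Id))
    (h0 h : ℝ → Stt n → ℝ) : Prop :=
  ∃ β : ℝ → ℝ → ℝ, ∃ ρ : ℝ → ℝ, ClassKL β ∧ ClassKInf ρ ∧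
    ∀ σ ∈ SW, ∀ (t0 : ℝ) (x0 : Stt n) (u : ℝ → Stt m) (T : EReal) (x : ℝ → Stt n),
      0 ≤ t0 → IsInput u → IsMaxSolution σ.γ (swF F σ) (swG G σ) t0 x0 u T x →
      ∀ t : ℝ, t0 ≤ t → (t : EReal) < T →
        h t (x t) ≤ β (h0 t0 x0) (t - t0) + ρ (inputNorm σ.γ u (Set.Ioc t0 t))

/-- Strong `(h⁰,h)`-ISS of the family `{Σ_σ}_{σ ∈ SW}`. -/
def SwStronglyISS {n m : ℕ} {Ic Id : Type*} (F : Ic → ℝ → Stt n → Stt m → Stt n)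
    (G : Id → ℝ → Stt n → Stt m → Stt n) (SW : Set (SwSignal Ic Id))
    (h0 h : ℝ → Stt n → ℝ) : Prop :=
  ∃ β : ℝ → ℝ → ℝ, ∃ ρ : ℝ → ℝ, ClassKL β ∧ ClassKInf ρ ∧
    ∀ σ ∈ SW, ∀ (t0 : ℝ) (x0 : Stt n) (u : ℝ → Stt m) (T : EReal) (x : ℝ → Stt n),
      0 ≤ t0 → IsInput u → IsMaxSolution σ.γ (swF F σ) (swG G σ) t0 x0 u T x →
      ∀ t : ℝ, t0 ≤ t → (t : EReal) < T →
        h t (x t) ≤ β (h0 t0 x0) (t - t0 + (nJumps σ.γ t0 t : ℝ)) +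
          ρ (inputNorm σ.γ u (Set.Ioc t0 t))

/-- Total activation time in `(t0,t]` of the flow modes in `A`. -/
def actT {Ic Id : Type*} (σ : SwSignal Ic Id) (A : Set Ic) (t0 t : ℝ) : ℝ :=
  (MeasureTheory.volume {r : ℝ | r ∈ Set.Ioc t0 t ∧ σ.σ1 r ∈ A}).toReal

/-- Number of impulse times in `(t0,t]` whose mode combination lies in `Jp`. -/
def nJumpsIn {Ic Id : Type*} (σ : SwSignal Ic Id) (Jp : Set (Ic × Ic × Id))
    (t0 t : ℝ) : ℕ :=
  (σ.γ ∩ Set.Ioc t0 t ∩ {r : ℝ | (σ.σ1m r, σ.σ1 r, σ.σ2 r) ∈ Jp}).ncard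

/-- Assumption 2 of the paper (for switched impulsive systems), data explicit. -/
def Assumption2 {n m : ℕ} {Ic Id : Type*}
    (F : Ic → ℝ → Stt n → Stt m → Stt n) (G : Id → ℝ → Stt n → Stt m → Stt n)
    (h0 h : ℝ → Stt n → ℝ) (J : Set (Ic × Ic × Id))
    (v : Ic → ℝ → Stt n → ℝ) (φ1 φ2 χ π : ℝ → ℝ)
    (vφ : Ic → ℝ → ℝ → ℝ) (al : Ic × Ic × Id → ℝ → ℝ → ℝ) : Prop :=
  ClassKInf φ1 ∧ ClassKInf φ2 ∧ ClassKInf χ ∧ ClassKInf π ∧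
  (∀ i : Ic, LocLipschitzOn ((Set.Ici (0 : ℝ)) ×ˢ (Set.univ : Set (Stt n)))
      (fun q : ℝ × Stt n => v i q.1 q.2)) ∧
  (∀ i : Ic, Caratheodory2 (vφ i)) ∧
  (∀ e ∈ J, ∀ t r : ℝ, 0 ≤ t → 0 ≤ r → 0 ≤ al e t r) ∧
  (∀ (i : Ic) (t : ℝ) (ξ : Stt n), 0 ≤ t →
    φ1 (h t ξ) ≤ v i t ξ ∧ v i t ξ ≤ φ2 (h0 t ξ)) ∧
  (∀ (i : Ic) (t : ℝ) (ξ : Stt n) (μ : Stt m), 0 ≤ t → χ ‖μ‖ ≤ v i t ξ →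
    DiniAlong (F i) (v i) t ξ μ ≤ - vφ i t (v i t ξ)) ∧
  (∀ (ι i : Ic) (j : Id), (ι, i, j) ∈ J → ∀ (t : ℝ) (ξ : Stt n) (μ : Stt m),
    0 ≤ t → χ ‖μ‖ ≤ v ι t ξ → v i t (ξ + G j t ξ μ) ≤ al (ι, i, j) t (v ι t ξ)) ∧
  (∀ (ι i : Ic) (j : Id), (ι, i, j) ∈ J → ∀ (t : ℝ) (ξ : Stt n) (μ : Stt m),
    0 ≤ t → v ι t ξ ≤ χ ‖μ‖ → v i t (ξ + G j t ξ μ) ≤ π ‖μ‖)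

lemma ClassKInf.nonneg {α : ℝ → ℝ} (h : ClassKInf α) {r : ℝ} (hr : 0 ≤ r) : 0 ≤ α r := by
  have := h.2.1.monotoneOn (mem_Ici.2 le_rfl) (mem_Ici.2 hr) hr
  rwa [h.2.2.1] at this

lemma ClassKInf.mono {α : ℝ → ℝ} (h : ClassKInf α) {r s : ℝ} (hr : 0 ≤ r) (hrs : r ≤ s) :
    α r ≤ α s :=
  h.2.1.monotoneOn (mem_Ici.2 hr) (mem_Ici.2 (hr.trans hrs)) hrs

lemma ClassKInf.comp {α β : ℝ → ℝ} (hα : ClassKInf α) (hβ : ClassKInf β) :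
    ClassKInf fun r => α (β r) := by
  refine ⟨hα.1.comp hβ.1 fun r hr => hβ.nonneg hr, ?_, ?_, fun M => ?_⟩
  · intro r hr s hs hrs
    exact hα.2.1 (hβ.nonneg hr) (hβ.nonneg hs) (hβ.2.1 hr hs hrs)
  · simp [hβ.2.2.1, hα.2.2.1]
  · obtain ⟨r, hr, hM⟩ := hα.2.2.2 M
    obtain ⟨s, hs, hr'⟩ := hβ.2.2.2 r
    exact ⟨s, hs, hM.trans (hα.mono hr hr')⟩

lemma ClassKInf.max {α β : ℝ → ℝ} (hα : ClassKInf α) (hβ : ClassKInf β) :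
    ClassKInf fun r => max (α r) (β r) := by
  refine ⟨hα.1.sup hβ.1, ?_, ?_, fun M => ?_⟩
  · intro r hr s hs hrs
    exact max_lt_max (hα.2.1 hr hs hrs) (hβ.2.1 hr hs hrs)
  · simp [hβ.2.2.1, hα.2.2.1]
  · obtain ⟨r, hr, hM⟩ := hα.2.2.2 M
    exact ⟨r, hr, hM.trans (le_max_left _ _)⟩

/-- A class `K∞` function has a class `K∞` left inverse on `[0,∞)`. -/
lemma ClassKInf.exists_inverse {α : ℝ → ℝ} (h : ClassKInf α) :
    ∃ ψ : ℝ → ℝ, ClassKInf ψ ∧ ∀ r : ℝ, 0 ≤ r → ψ (α r) = r := by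
  let F : Ici (0 : ℝ) → Ici (0 : ℝ) := fun r => ⟨α r, h.nonneg r.2⟩
  have hF : StrictMono F := fun r s hrs => h.2.1 r.2 s.2 hrs
  have hsurj : Function.Surjective F := by
    rintro ⟨y, hy⟩
    obtain ⟨r, hr, hM⟩ := h.2.2.2 y
    have hc : ContinuousOn α (Icc 0 r) := h.1.mono Icc_subset_Ici_self
    obtain ⟨x, hx, hxy⟩ := intermediate_value_Icc hr hc ⟨by rw [h.2.2.1]; exact hy, hM⟩
    exact ⟨⟨x, hx.1⟩, Subtype.ext hxy⟩
  let e := hF.orderIsoOfSurjective F hsurj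
  have he : ∀ r, e.symm (F r) = r := fun r => e.symm_apply_apply r
  have heq : ∀ r : ℝ, 0 ≤ r → (e.symm (projIci 0 (α r)) : ℝ) = r := by
    intro r hr
    rw [projIci_of_mem (h.nonneg hr)]
    exact congrArg Subtype.val (he ⟨r, hr⟩)
  refine ⟨fun y => (e.symm (projIci 0 y) : ℝ), ⟨?_, ?_, ?_, fun M => ?_⟩, heq⟩
  · exact (continuous_subtype_val.comp
      (e.symm.continuous.comp ((continuous_const.max continuous_id).subtype_mk _))).continuousOn
  · intro r hr s hs hrs
    have : e.symm (projIci 0 r) < e.symm (projIci 0 s) := by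
      rw [e.symm.lt_iff_lt, projIci_of_mem hr, projIci_of_mem hs]
      exact hrs
    exact this
  · have := heq 0 le_rfl
    rwa [h.2.2.1] at this
  · refine ⟨α (Max.max M 0), h.nonneg (le_max_right _ _), ?_⟩
    have := heq (Max.max M 0) (le_max_right _ _)
    simp only [this]
    exact le_max_left _ _

lemma ClassKL.nonneg {β : ℝ → ℝ → ℝ} (hβ : ClassKL β) {r t : ℝ} (hr : 0 ≤ r) (ht : 0 ≤ t) :
    0 ≤ β r t :=
  (hβ.1 t ht).nonneg hr

lemma ClassKL.le_zero_time {β : ℝ → ℝ → ℝ} (hβ : ClassKL β) {r t : ℝ} (hr : 0 ≤ r)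
    (ht : 0 ≤ t) : β r t ≤ β r 0 :=
  (hβ.2 r hr).1 (mem_Ici.2 le_rfl) (mem_Ici.2 ht) ht

lemma ClassKL.comp {β : ℝ → ℝ → ℝ} (hβ : ClassKL β) {ψ φ : ℝ → ℝ} (hψ : ClassKInf ψ)
    (hφ : ClassKInf φ) : ClassKL fun r t => ψ (β (φ r) t) := by
  refine ⟨fun t ht => hψ.comp ((hβ.1 t ht).comp hφ), fun r hr => ⟨?_, ?_⟩⟩
  · intro s hs t ht hst
    exact hψ.mono (hβ.nonneg (hφ.nonneg hr) ht) ((hβ.2 _ (hφ.nonneg hr)).1 hs ht hst)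
  · have h0 : Tendsto ψ (nhdsWithin 0 (Ici 0)) (nhds 0) := by
      have := hψ.1 0 (mem_Ici.2 le_rfl)
      rwa [ContinuousWithinAt, hψ.2.2.1] at this
    refine h0.comp (tendsto_nhdsWithin_iff.2 ⟨(hβ.2 _ (hφ.nonneg hr)).2, ?_⟩)
    filter_upwards [eventually_ge_atTop 0] with t ht
    exact hβ.nonneg (hφ.nonneg hr) ht

lemma IsImpulseSeq.exists_isolated {γ : Set ℝ} (hγ : IsImpulseSeq γ) (t : ℝ) :
    ∃ ε : ℝ, 0 < ε ∧ ∀ s ∈ γ, s ∈ Icc (t - ε) (t + ε) → s = t := by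
  have hfin : ((γ ∩ Iic (t + 1)) \ {t}).Finite := (hγ.2 (t + 1)).subset sdiff_subset
  have hmem : ((γ ∩ Iic (t + 1)) \ {t})ᶜ ∈ nhds t :=
    hfin.isClosed.isOpen_compl.mem_nhds (by simp)
  obtain ⟨δ, hδ, hball⟩ := Metric.mem_nhds_iff.1 hmem
  refine ⟨min (δ / 2) 1, by positivity, fun s hs hst => ?_⟩
  by_contra hne
  have h1 : min (δ / 2) 1 ≤ δ / 2 := min_le_left _ _
  have h2 : min (δ / 2) 1 ≤ 1 := min_le_right _ _
  have : s ∈ Metric.ball t δ := by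
    rw [Metric.mem_ball, Real.dist_eq, abs_lt]
    constructor <;> linarith [hst.1, hst.2]
  exact hball this ⟨⟨hs, by rw [mem_Iic]; linarith [hst.2]⟩, hne⟩

/-- `z` is absolutely continuous on `[a,b]` and solves `ż ≤ -φ(t,z)` almost everywhere there. -/
def FlowOn (φ : ℝ → ℝ → ℝ) (z : ℝ → ℝ) (a b : ℝ) : Prop :=
  ∃ d : ℝ → ℝ, IntegrableOn d (Icc a b) ∧
    (∀ᵐ s ∂volume, s ∈ Icc a b → d s ≤ - φ s (z s)) ∧
    ∀ t ∈ Icc a b, z t = z a + ∫ s in a..t, d s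

lemma FlowOn.refl (φ : ℝ → ℝ → ℝ) (z : ℝ → ℝ) (a : ℝ) : FlowOn φ z a a := by
  refine ⟨fun _ => 0, integrableOn_zero, ?_, fun t ht => ?_⟩
  · have : ∀ᵐ s ∂volume, s ≠ a := by simp [ae_iff, measure_singleton]
    filter_upwards [this] with s hs hsa
    exact absurd (le_antisymm hsa.2 hsa.1) hs
  · have : t = a := le_antisymm ht.2 ht.1
    simp [this]

lemma FlowOn.congr {φ : ℝ → ℝ → ℝ} {z z' : ℝ → ℝ} {a b : ℝ} (h : FlowOn φ z a b)
    (hab : a ≤ b) (heq : ∀ s ∈ Icc a b, z' s = z s) : FlowOn φ z' a b := by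
  obtain ⟨d, hd, hle, hint⟩ := h
  refine ⟨d, hd, ?_, fun t ht => ?_⟩
  · filter_upwards [hle] with s hs hsab
    rw [heq s hsab]
    exact hs hsab
  · rw [heq t ht, heq a ⟨le_rfl, hab⟩]
    exact hint t ht

lemma FlowOn.trans {φ : ℝ → ℝ → ℝ} {z : ℝ → ℝ} {a b c : ℝ} (hab : a ≤ b) (hbc : b ≤ c)
    (h1 : FlowOn φ z a b) (h2 : FlowOn φ z b c) : FlowOn φ z a c := by
  obtain ⟨d1, hd1, hle1, hint1⟩ := h1
  obtain ⟨d2, hd2, hle2, hint2⟩ := h2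
  have hI1 : IntegrableOn (fun s => if s ≤ b then d1 s else d2 s) (Icc a b) :=
    hd1.congr_fun (fun s hs => by simp [hs.2]) measurableSet_Icc
  have hI2 : IntegrableOn (fun s => if s ≤ b then d1 s else d2 s) (Ioc b c) :=
    (hd2.mono_set Ioc_subset_Icc_self).congr_fun
      (fun s hs => by simp [not_le.2 hs.1]) measurableSet_Ioc
  have hE1 : ∀ t ∈ Icc a b,
      ∫ s in a..t, (if s ≤ b then d1 s else d2 s) = ∫ s in a..t, d1 s := by
    intro t ht
    refine intervalIntegral.integral_congr fun s hs => ?_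
    rw [uIcc_of_le ht.1] at hs
    simp [hs.2.trans ht.2]
  refine ⟨fun s => if s ≤ b then d1 s else d2 s, ?_, ?_, fun t ht => ?_⟩
  · rw [← Icc_union_Ioc_eq_Icc hab hbc]
    exact hI1.union hI2
  · filter_upwards [hle1, hle2] with s hs1 hs2 hs
    by_cases hsb : s ≤ b
    · simpa [hsb] using hs1 ⟨hs.1, hsb⟩
    · simpa [hsb] using hs2 ⟨(not_le.1 hsb).le, hs.2⟩
  · rcases le_total t b with htb | htb
    · rw [hE1 t ⟨ht.1, htb⟩]
      exact hint1 t ⟨ht.1, htb⟩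
    · have hb1 : IntervalIntegrable (fun s => if s ≤ b then d1 s else d2 s) volume a b :=
        (intervalIntegrable_iff_integrableOn_Ioc_of_le hab).2 (hI1.mono_set Ioc_subset_Icc_self)
      have hb2 : IntervalIntegrable (fun s => if s ≤ b then d1 s else d2 s) volume b t :=
        (intervalIntegrable_iff_integrableOn_Ioc_of_le htb).2
          (hI2.mono_set (Ioc_subset_Ioc_right ht.2))
      have hE2 : ∫ s in b..t, (if s ≤ b then d1 s else d2 s) = ∫ s in b..t, d2 s := by
        refine intervalIntegral.integral_congr_ae (Eventually.of_forall fun s hs => ?_)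
        rw [uIoc_of_le htb] at hs
        simp [not_le.2 hs.1]
      rw [← intervalIntegral.integral_add_adjacent_intervals hb1 hb2,
        hE1 b ⟨hab, le_rfl⟩, hE2, hint2 t ⟨htb, ht.2⟩, hint1 b ⟨hab, le_rfl⟩]
      ring

/-- A family of solutions of `ż ≤ -φ(t,z)`, obtained by descending at a dominating rate. -/
lemma Caratheodory2.exists_descent {φ : ℝ → ℝ → ℝ} (hφ : Caratheodory2 φ) {a b : ℝ}
    (hab : a ≤ b) (C : ℝ) :
    ∃ N : ℝ → ℝ, ContinuousOn N (Icc a b) ∧ MonotoneOn N (Icc a b) ∧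
      ∀ K t1 t2 : ℝ, a ≤ t1 → t1 ≤ t2 → t2 ≤ b →
        (∀ s ∈ Icc t1 t2, K - N s ∈ Icc 0 C) → FlowOn φ (fun s => K - N s) t1 t2 := by
  obtain ⟨m, hm, hbound⟩ := hφ.2.2 a b C
  have hI : IntegrableOn (fun s => |m s|) (Icc a b) := hm.abs
  have hII : ∀ s t : ℝ, a ≤ s → s ≤ t → t ≤ b →
      IntervalIntegrable (fun s => |m s|) volume s t := fun s t h1 h2 h3 =>
    (intervalIntegrable_iff_integrableOn_Icc_of_le h2).2 (hI.mono_set (Icc_subset_Icc h1 h3))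
  have hadd : ∀ s t : ℝ, a ≤ s → s ≤ t → t ≤ b →
      ∫ r in a..t, |m r| = (∫ r in a..s, |m r|) + ∫ r in s..t, |m r| := fun s t h1 h2 h3 =>
    (intervalIntegral.integral_add_adjacent_intervals (hII a s le_rfl h1 (h2.trans h3))
      (hII s t h1 h2 h3)).symm
  refine ⟨fun t => ∫ r in a..t, |m r|, ?_, ?_, ?_⟩
  · have := intervalIntegral.continuousOn_primitive_interval (μ := volume)
      (f := fun s => |m s|) (a := a) (b := b) (by rwa [uIcc_of_le hab])
    rwa [uIcc_of_le hab] at this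
  · intro s hs t ht hst
    simp only
    rw [hadd s t hs.1 hst ht.2]
    have : 0 ≤ ∫ r in s..t, |m r| :=
      intervalIntegral.integral_nonneg hst fun r _ => abs_nonneg _
    linarith
  · intro K t1 t2 h1 h12 h2 hK
    refine ⟨fun s => - |m s|, (hI.mono_set (Icc_subset_Icc h1 h2)).neg,
      Eventually.of_forall fun s hs => ?_, fun t ht => ?_⟩
    · have h3 := hbound s ⟨h1.trans hs.1, hs.2.trans h2⟩ _ (hK s hs)
      have h4 := (le_abs_self _).trans (h3.trans (le_abs_self (m s)))
      simpa using h4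
    · simp only
      rw [hadd t1 t h1 ht.1 (ht.2.trans h2), intervalIntegral.integral_neg]
      ring

/-- A bound valid for all comparison solutions of one system. -/
def CompBound (γ : Set ℝ) (φ al : ℝ → ℝ → ℝ) (β : ℝ → ℝ → ℝ) : Prop :=
  ∀ (t0 z0 : ℝ) (T : EReal) (z : ℝ → ℝ), 0 ≤ t0 → 0 ≤ z0 → IsCompSol γ φ al t0 z0 T z →
    ∀ t : ℝ, t0 ≤ t → (t : EReal) < T → z t ≤ β z0 (t - t0 + (nJumps γ t0 t : ℝ))

/-- The comparison bound applies to solutions given on a compact interval only. -/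
lemma CompBound.apply_Icc {γ : Set ℝ} {φ al β : ℝ → ℝ → ℝ} (hB : CompBound γ φ al β)
    (hβ : ClassKL β) (hγ : IsImpulseSeq γ) (hφ : Caratheodory2 φ) {t0 t : ℝ} {z : ℝ → ℝ}
    (ht0 : 0 ≤ t0) (htt : t0 ≤ t) (hz : ∀ s ∈ Icc t0 t, 0 ≤ z s)
    (hflow : ∀ t1 t2 : ℝ, t0 ≤ t1 → t1 ≤ t2 → t2 ≤ t → Ioc t1 t2 ∩ γ = ∅ → FlowOn φ z t1 t2)
    (hjump : ∀ τ ∈ γ, t0 < τ → τ ≤ t →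
      ∃ L : ℝ, Tendsto z (nhdsWithin τ (Iio τ)) (nhds L) ∧ z τ ≤ al τ L) :
    z t ≤ β (z t0) (t - t0 + (nJumps γ t0 t : ℝ)) := by
  have hz0 := hz t0 ⟨le_rfl, htt⟩
  rcases (hz t ⟨htt, le_rfl⟩).eq_or_lt with h0 | hpos
  · rw [← h0]
    have : 0 ≤ t - t0 := by linarith
    exact hβ.nonneg hz0 (by positivity)
  obtain ⟨ε1, hε1, hiso⟩ := hγ.exists_isolated t
  obtain ⟨N, hNc, hNm, hNf⟩ := hφ.exists_descent (a := t) (b := t + 1) (by linarith) (z t)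
  have hmem : (t : ℝ) ∈ Icc t (t + 1) := ⟨le_rfl, by linarith⟩
  obtain ⟨δ, hδ, hN⟩ := Metric.continuousWithinAt_iff.1 (hNc t hmem) (z t) hpos
  obtain ⟨ε, hε, hεε1, hεδ, hε1'⟩ : ∃ ε : ℝ, 0 < ε ∧ ε ≤ ε1 ∧ ε < δ ∧ ε ≤ 1 :=
    ⟨min (min ε1 (δ / 2)) 1, by positivity, (min_le_left _ _).trans (min_le_left _ _),
      ((min_le_left _ _).trans (min_le_right _ _)).trans_lt (by linarith), min_le_right _ _⟩
  have hrange : ∀ s ∈ Icc t (t + ε), z t + N t - N s ∈ Icc 0 (z t) := by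
    intro s hs
    have hs' : s ∈ Icc t (t + 1) := ⟨hs.1, by linarith [hs.2]⟩
    have h1 := hNm hmem hs' hs.1
    have h2 := hN hs' (by rw [Real.dist_eq, abs_lt]; constructor <;> linarith [hs.1, hs.2])
    rw [Real.dist_eq, abs_lt] at h2
    constructor <;> linarith [h2.1, h2.2]
  set zz : ℝ → ℝ := fun s => if s ≤ t then z s else z t + N t - N s with hzz
  have hzl : ∀ s, s ≤ t → zz s = z s := fun s hs => by simp [hzz, hs]
  have hzr : ∀ s, t ≤ s → zz s = z t + N t - N s := fun s hs => by
    rcases hs.eq_or_lt with rfl | hs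
    · simp [hzz]
    · simp [hzz, not_le.2 hs]
  have hfl : ∀ t1 t2 : ℝ, t0 ≤ t1 → t1 ≤ t2 → t2 ≤ t → Ioc t1 t2 ∩ γ = ∅ →
      FlowOn φ zz t1 t2 := fun t1 t2 h1 h12 h2 he =>
    (hflow t1 t2 h1 h12 h2 he).congr h12 fun s hs => hzl s (hs.2.trans h2)
  have hfr : ∀ t1 t2 : ℝ, t ≤ t1 → t1 ≤ t2 → t2 ≤ t + ε → FlowOn φ zz t1 t2 :=
    fun t1 t2 h1 h12 h2 =>
    (hNf (z t + N t) t1 t2 h1 h12 (by linarith) fun s hs =>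
      hrange s ⟨h1.trans hs.1, hs.2.trans h2⟩).congr h12 fun s hs => hzr s (h1.trans hs.1)
  have hsol : IsCompSol γ φ al t0 (z t0) ((t + ε : ℝ) : EReal) zz := by
    refine ⟨?_, hzl t0 htt, ?_, ?_, ?_⟩
    · exact EReal.coe_lt_coe_iff.2 (by linarith)
    · intro s hs hsT
      have hsT' := EReal.coe_lt_coe_iff.1 hsT
      rcases le_total s t with hst | hst
      · rw [hzl s hst]
        exact hz s ⟨hs, hst⟩
      · rw [hzr s hst]
        exact (hrange s ⟨hst, hsT'.le⟩).1
    · intro t1 t2 h1 h12 h2T he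
      have h2T' := EReal.coe_lt_coe_iff.1 h2T
      change FlowOn φ zz t1 t2
      rcases le_total t2 t with h2 | h2
      · exact hfl t1 t2 h1 h12 h2 he
      rcases le_total t t1 with h3 | h3
      · exact hfr t1 t2 h3 h12 h2T'.le
      · refine (hfl t1 t h1 h3 le_rfl ?_).trans h3 h2 (hfr t t2 le_rfl h2 h2T'.le)
        exact subset_eq_empty (inter_subset_inter_left _ (Ioc_subset_Ioc_right h2)) he
    · intro τ hτ h0τ hτT
      have hτT' := EReal.coe_lt_coe_iff.1 hτT
      have hτt : τ ≤ t := by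
        by_contra hlt
        have := hiso τ hτ ⟨by linarith, by linarith⟩
        exact hlt this.le
      obtain ⟨L, hL, hLe⟩ := hjump τ hτ h0τ hτt
      refine ⟨L, hL.congr' ?_, by rwa [hzl τ hτt]⟩
      filter_upwards [self_mem_nhdsWithin] with s hs
      exact (hzl s ((mem_Iio.1 hs).le.trans hτt)).symm
  have := hB t0 (z t0) _ zz ht0 hz0 hsol t htt (EReal.coe_lt_coe_iff.2 (by linarith))
  rwa [hzl t le_rfl] at this

/-- Jumps of the comparison system are bounded by the comparison bound. -/
lemma CompBound.jump_le {γ : Set ℝ} {φ al β : ℝ → ℝ → ℝ} (hB : CompBound γ φ al β)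
    (hβ : ClassKL β) (hγ : IsImpulseSeq γ) (hφ : Caratheodory2 φ)
    (hal : ∀ t r : ℝ, 0 ≤ t → 0 ≤ r → 0 ≤ al t r) {τ L : ℝ} (hτ : τ ∈ γ) (hL : 0 ≤ L) :
    al τ L ≤ β L 0 := by
  have hτ0 : 0 < τ := hγ.1 hτ
  have key : ∀ η : ℝ, 0 < η → al τ L ≤ β (L + η) 0 := by
    intro η hη
    obtain ⟨ε1, hε1, hiso⟩ := hγ.exists_isolated τ
    obtain ⟨N, hNc, hNm, hNf⟩ :=
      hφ.exists_descent (a := τ - 1) (b := τ) (by linarith) (L + η)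
    have hmem : (τ : ℝ) ∈ Icc (τ - 1) τ := ⟨by linarith, le_rfl⟩
    obtain ⟨δ, hδ, hN⟩ := Metric.continuousWithinAt_iff.1 (hNc τ hmem) η hη
    obtain ⟨ε, hε, hεε1, hεδ, hε1', hετ⟩ :
        ∃ ε : ℝ, 0 < ε ∧ ε ≤ ε1 ∧ ε < δ ∧ ε ≤ 1 ∧ ε ≤ τ :=
      ⟨min (min ε1 (δ / 2)) (min 1 τ), by positivity, (min_le_left _ _).trans (min_le_left _ _),
        ((min_le_left _ _).trans (min_le_right _ _)).trans_lt (by linarith),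
        (min_le_right _ _).trans (min_le_left _ _), (min_le_right _ _).trans (min_le_right _ _)⟩
    have hrange : ∀ s ∈ Icc (τ - ε) τ, L + N τ - N s ∈ Icc L (L + η) := by
      intro s hs
      have hs' : s ∈ Icc (τ - 1) τ := ⟨by linarith [hs.1], hs.2⟩
      have h1 := hNm hs' hmem hs.2
      have h2 := hN hs' (by rw [Real.dist_eq, abs_lt]; constructor <;> linarith [hs.1, hs.2])
      rw [Real.dist_eq, abs_lt] at h2
      constructor <;> linarith [h2.1, h2.2]
    set zz : ℝ → ℝ := fun s => if s < τ then L + N τ - N s else al τ L with hzz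
    have hzl : ∀ s, s < τ → zz s = L + N τ - N s := fun s hs => by simp [hzz, hs]
    have hzτ : zz τ = al τ L := by simp [hzz]
    have hstart : zz (τ - ε) ∈ Icc L (L + η) := by
      rw [hzl _ (by linarith)]
      exact hrange _ ⟨le_rfl, by linarith⟩
    have := hB.apply_Icc hβ hγ hφ (t0 := τ - ε) (t := τ) (z := zz) (by linarith) (by linarith)
      ?_ ?_ ?_
    · rw [hzτ] at this
      have ht : 0 ≤ τ - (τ - ε) + (nJumps γ (τ - ε) τ : ℝ) := by
        have : τ - (τ - ε) = ε := by ring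
        rw [this]
        positivity
      have h0 : 0 ≤ zz (τ - ε) := hL.trans hstart.1
      exact this.trans ((hβ.le_zero_time h0 ht).trans ((hβ.1 0 le_rfl).mono h0 hstart.2))
    · intro s hs
      rcases hs.2.eq_or_lt with rfl | hlt
      · rw [hzτ]
        exact hal _ _ hτ0.le hL
      · rw [hzl s hlt]
        exact hL.trans (hrange s hs).1
    · intro t1 t2 h1 h12 h2 he
      rcases h12.eq_or_lt with rfl | h12'
      · exact FlowOn.refl _ _ _
      have h2' : t2 < τ := by
        refine lt_of_le_of_ne h2 fun h => ?_
        subst h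
        exact (eq_empty_iff_forall_notMem.1 he) t2 ⟨⟨h12', le_rfl⟩, hτ⟩
      refine (hNf (L + N τ) t1 t2 (by linarith) h12 h2 fun s hs => ?_).congr h12
        fun s hs => hzl s (hs.2.trans_lt h2')
      have := hrange s ⟨h1.trans hs.1, hs.2.trans h2⟩
      exact ⟨hL.trans this.1, this.2⟩
    · intro s hs h1 h2
      have hsτ : s = τ := hiso s hs ⟨by linarith, by linarith⟩
      subst hsτ
      refine ⟨L, ?_, hzτ.le⟩
      have hc : Tendsto (fun r => L + N s - N r) (nhdsWithin s (Icc (s - 1) s)) (nhds L) := by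
        have := (tendsto_const_nhds (x := L + N s)).sub (hNc s hmem)
        simpa using this
      have hle : nhdsWithin s (Iio s) ≤ nhdsWithin s (Icc (s - 1) s) := by
        refine nhdsWithin_le_of_mem ?_
        exact mem_of_superset (Ioo_mem_nhdsLT (by linarith)) Ioo_subset_Icc_self
      refine (hc.mono_left hle).congr' ?_
      filter_upwards [self_mem_nhdsWithin] with r hr
      exact (hzl r hr).symm
  have hc : Tendsto (fun η => β (L + η) 0) (nhdsWithin 0 (Ioi 0)) (nhds (β L 0)) := by
    have h1 := (hβ.1 0 le_rfl).1 L (mem_Ici.2 hL)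
    refine h1.tendsto.comp (tendsto_nhdsWithin_iff.2 ⟨?_, ?_⟩)
    · have : Tendsto (fun η : ℝ => L + η) (nhds 0) (nhds (L + 0)) :=
        (continuous_const.add continuous_id).tendsto 0
      rw [add_zero] at this
      exact this.mono_left nhdsWithin_le_nhds
    · filter_upwards [self_mem_nhdsWithin] with η hη
      exact add_nonneg hL (mem_Ioi.1 hη).le
  exact ge_of_tendsto hc (by
    filter_upwards [self_mem_nhdsWithin] with η hη
    exact key η hη)

/-- The comparison estimate for a scalar function which satisfies the comparison inclusion only
where it exceeds the threshold `c`. -/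
lemma CompBound.le_of_threshold {γ : Set ℝ} {φ al β : ℝ → ℝ → ℝ} (hB : CompBound γ φ al β)
    (hβ : ClassKL β) (hγ : IsImpulseSeq γ) (hφ : Caratheodory2 φ)
    (hal : ∀ t r : ℝ, 0 ≤ t → 0 ≤ r → 0 ≤ al t r) {t0 t c p : ℝ} {v : ℝ → ℝ}
    (ht0 : 0 ≤ t0) (htt : t0 ≤ t) (hv : ∀ s ∈ Icc t0 t, 0 ≤ v s)
    (hflow : ∀ t1 t2 : ℝ, t0 ≤ t1 → t1 ≤ t2 → t2 ≤ t → Ioc t1 t2 ∩ γ = ∅ →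
      (∀ s ∈ Ioc t1 t2, c ≤ v s) → FlowOn φ v t1 t2)
    (hleft : ∀ τ ∈ Ioc t0 t, τ ∉ γ → Tendsto v (nhdsWithin τ (Iio τ)) (nhds (v τ)))
    (hjump : ∀ τ ∈ Ioc t0 t, τ ∈ γ → ∃ L : ℝ, 0 ≤ L ∧
      Tendsto v (nhdsWithin τ (Iio τ)) (nhds L) ∧ (c ≤ L → v τ ≤ al τ L) ∧
      (L ≤ c → v τ ≤ max p (al τ L))) :
    v t ≤ max (β (v t0) (t - t0 + (nJumps γ t0 t : ℝ)))
      (β (max (max c p) (β c 0)) 0) := by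
  have above : ∀ a ∈ Icc t0 t, (∀ s ∈ Ioc a t, c < v s) →
      v t ≤ β (v a) (t - a + (nJumps γ a t : ℝ)) := by
    intro a ha hgt
    refine hB.apply_Icc hβ hγ hφ (ht0.trans ha.1) ha.2 (fun s hs => hv s ⟨ha.1.trans hs.1, hs.2⟩)
      (fun t1 t2 h1 h12 h2 he => hflow t1 t2 (ha.1.trans h1) h12 h2 he fun s hs =>
        (hgt s ⟨h1.trans_lt hs.1, hs.2.trans h2⟩).le) fun τ hτ haτ hτt => ?_
    obtain ⟨L, _, hL, hge, _⟩ := hjump τ ⟨ha.1.trans_lt haτ, hτt⟩ hτ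
    refine ⟨L, hL, hge (ge_of_tendsto hL ?_)⟩
    filter_upwards [Ioo_mem_nhdsLT haτ] with s hs
    exact (hgt s ⟨hs.1, hs.2.le.trans hτt⟩).le
  by_cases hS : ∀ s ∈ Icc t0 t, c < v s
  · exact (above t0 ⟨le_rfl, htt⟩ fun s hs => hS s (Ioc_subset_Icc_self hs)).trans
      (le_max_left _ _)
  push Not at hS
  obtain ⟨r, hr, hvr⟩ := hS
  set S : Set ℝ := {s | s ∈ Icc t0 t ∧ v s ≤ c} with hSdef
  have hbdd : BddAbove S := ⟨t, fun s hs => hs.1.2⟩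
  have hrS : r ∈ S := ⟨hr, hvr⟩
  set a := sSup S with ha
  have haI : a ∈ Icc t0 t := ⟨hr.1.trans (le_csSup hbdd hrS), csSup_le ⟨r, hrS⟩ fun s hs => hs.1.2⟩
  have hva : v a ≤ max (max c p) (β c 0) := by
    by_cases haS : a ∈ S
    · exact haS.2.trans ((le_max_left _ _).trans (le_max_left _ _))
    have hfreq : ∃ᶠ s in nhdsWithin a (Iio a), v s ≤ c := by
      rw [Filter.frequently_iff]
      intro W hW
      obtain ⟨l, hl, hlW⟩ := (mem_nhdsLT_iff_exists_Ioo_subset' (sub_one_lt a)).1 hW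
      obtain ⟨s, hs, hls⟩ := exists_lt_of_lt_csSup ⟨r, hrS⟩ hl
      have hsa : s < a := lt_of_le_of_ne (le_csSup hbdd hs) fun h => haS (h ▸ hs)
      exact ⟨s, hlW ⟨hls, hsa⟩, hs.2⟩
    have hra : r < a := lt_of_le_of_ne (le_csSup hbdd hrS) fun h => haS (h ▸ hrS)
    have haIoc : a ∈ Ioc t0 t := ⟨hr.1.trans_lt hra, haI.2⟩
    by_cases haγ : a ∈ γ
    · obtain ⟨L, hL0, hL, _, hle⟩ := hjump a haIoc haγ
      have hLc : L ≤ c := le_of_tendsto_of_frequently hL hfreq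
      refine (hle hLc).trans (max_le ((le_max_right _ _).trans (le_max_left _ _)) ?_)
      exact ((hB.jump_le hβ hγ hφ hal haγ hL0).trans
        ((hβ.1 0 le_rfl).mono hL0 hLc)).trans (le_max_right _ _)
    · exact absurd ⟨haI, le_of_tendsto_of_frequently (hleft a haIoc haγ) hfreq⟩ haS
  have hvt := above a haI fun s hs => by
    by_contra hle
    exact absurd (le_csSup hbdd ⟨⟨haI.1.trans hs.1.le, hs.2⟩, not_lt.1 hle⟩) (not_le.2 hs.1)
  have hta : 0 ≤ t - a := by linarith [haI.2]
  have hva0 := hv a haI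
  exact (hvt.trans ((hβ.le_zero_time hva0 (by positivity)).trans
    ((hβ.1 0 le_rfl).mono hva0 hva))).trans (le_max_right _ _)

lemma AbsolutelyContinuousOnInterval.of_dist_le {X Y : Type*} [PseudoMetricSpace X]
    [PseudoMetricSpace Y] {f : ℝ → X} {G : ℝ → Y} {a b K : ℝ}
    (hG : AbsolutelyContinuousOnInterval G a b)
    (h : ∀ s ∈ uIcc a b, ∀ t ∈ uIcc a b, dist (f s) (f t) ≤ K * dist (G s) (G t)) :
    AbsolutelyContinuousOnInterval f a b := by
  have h0 := Tendsto.const_mul K hG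
  rw [mul_zero] at h0
  refine squeeze_zero' (Eventually.of_forall fun E => Finset.sum_nonneg fun _ _ => dist_nonneg)
    ?_ h0
  have hmem : AbsolutelyContinuousOnInterval.disjWithin a b ∈
      (AbsolutelyContinuousOnInterval.totalLengthFilter ⊓
        𝓟 (AbsolutelyContinuousOnInterval.disjWithin a b)) :=
    mem_inf_of_right (mem_principal_self _)
  filter_upwards [hmem] with E hE
  rw [Finset.mul_sum]
  exact Finset.sum_le_sum fun i hi => h _ (hE.1 i hi).1 _ (hE.1 i hi).2

/-- The Dini derivative along the flow map is the derivative along a differentiable trajectory. -/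
lemma diniAlong_eq_deriv {n m : ℕ} {f : ℝ → Stt n → Stt m → Stt n} {V : ℝ → Stt n → ℝ}
    {x : ℝ → Stt n} {μ : Stt m} {s a b : ℝ} (hs : s ∈ Ico a b)
    (hV : LocLipschitzOn (Ico a b ×ˢ (univ : Set (Stt n))) fun q : ℝ × Stt n => V q.1 q.2)
    (hx : HasDerivAt x (f s (x s) μ) s) (hv : DifferentiableAt ℝ (fun r => V r (x r)) s) :
    DiniAlong f V s (x s) μ = deriv (fun r => V r (x r)) s := by
  obtain ⟨K, W, hW, hK⟩ := hV (s, x s) ⟨hs, mem_univ _⟩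
  have htime : Tendsto (fun d : ℝ => s + d) (nhdsWithin 0 (Ioi 0)) (nhds s) := by
    have : Tendsto (fun d : ℝ => s + d) (nhds 0) (nhds (s + 0)) :=
      (continuous_const.add continuous_id).tendsto 0
    rw [add_zero] at this
    exact this.mono_left nhdsWithin_le_nhds
  have hstrip : ∀ᶠ d in nhdsWithin (0 : ℝ) (Ioi 0), s + d ∈ Ico a b := by
    filter_upwards [htime.eventually (eventually_lt_nhds hs.2), self_mem_nhdsWithin] with d h1 h2
    exact ⟨hs.1.trans (by linarith [mem_Ioi.1 h2]), h1⟩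
  have hmem : ∀ y : ℝ → Stt n, Tendsto y (nhdsWithin 0 (Ioi 0)) (nhds (x s)) →
      ∀ᶠ d in nhdsWithin (0 : ℝ) (Ioi 0), (s + d, y d) ∈ W := by
    intro y hy
    refine Tendsto.eventually (tendsto_nhdsWithin_iff.2 ⟨htime.prodMk_nhds hy, ?_⟩) hW
    filter_upwards [hstrip] with d hd
    exact ⟨hd, mem_univ _⟩
  have hlin : Tendsto (fun d : ℝ => x s + d • f s (x s) μ) (nhdsWithin 0 (Ioi 0))
      (nhds (x s)) := by
    have : Tendsto (fun d : ℝ => x s + d • f s (x s) μ) (nhds 0)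
        (nhds (x s + (0 : ℝ) • f s (x s) μ)) :=
      (continuous_const.add (continuous_id.smul continuous_const)).tendsto 0
    rw [zero_smul, add_zero] at this
    exact this.mono_left nhdsWithin_le_nhds
  have hslope := hv.hasDerivAt.tendsto_slope_zero_right
  have herr : Tendsto (fun d : ℝ =>
      (V (s + d) (x s + d • f s (x s) μ) - V (s + d) (x (s + d))) / d)
      (nhdsWithin 0 (Ioi 0)) (nhds 0) := by
    have hxs := (hx.tendsto_slope_zero_right.const_sub (f s (x s) μ)).norm.const_mul (K : ℝ)
    rw [sub_self, norm_zero, mul_zero] at hxs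
    refine squeeze_zero_norm' ?_ hxs
    filter_upwards [hmem _ hlin, hmem _ (hx.continuousAt.tendsto.comp htime),
      self_mem_nhdsWithin] with d h1 h2 hd
    have hd0 : 0 < d := hd
    have h3 := hK.dist_le_mul _ h1 _ h2
    simp only [Function.comp_apply, Prod.dist_eq, dist_self, max_eq_right dist_nonneg] at h3
    rw [dist_eq_norm, dist_eq_norm] at h3
    have h4 : x s + d • f s (x s) μ - x (s + d) =
        d • (f s (x s) μ - d⁻¹ • (x (s + d) - x s)) := by
      rw [smul_sub, smul_inv_smul₀ hd0.ne']
      abel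
    rw [h4, norm_smul, Real.norm_of_nonneg hd0.le] at h3
    rw [norm_div, Real.norm_of_nonneg hd0.le, div_le_iff₀ hd0]
    linarith
  have hsum := herr.add hslope
  rw [zero_add] at hsum
  refine (hsum.congr fun d => ?_).limsup_eq
  rw [smul_eq_mul]
  ring

section Trajectory

variable {n m : ℕ} {γ : Set ℝ} {f g : ℝ → Stt n → Stt m → Stt n} {t0 : ℝ} {x0 : Stt n}
  {u : ℝ → Stt m} {T : EReal} {x : ℝ → Stt n} {V Vm : ℝ → Stt n → ℝ}

lemma IsSolution.absolutelyContinuous_comp (hsol : IsSolution γ f g t0 x0 u T x)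
    (hγ : IsImpulseSeq γ) (hV : InClassV γ V Vm) (ht0 : 0 ≤ t0) {t1 t2 : ℝ} (h1 : t0 ≤ t1)
    (h12 : t1 ≤ t2) (h2 : (t2 : EReal) < T) (he : Ioc t1 t2 ∩ γ = ∅) :
    AbsolutelyContinuousOnInterval (fun s => V s (x s)) t1 t2 ∧
      ∀ᵐ s ∂volume, s ∈ Ioo t1 t2 →
        DiniAlong f V s (x s) (u s) = deriv (fun r => V r (x r)) s := by
  obtain ⟨ε, hε, hiso⟩ := hγ.exists_isolated t2
  have hIoo : Ioo t1 (t2 + ε) ∩ γ = ∅ := by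
    refine eq_empty_iff_forall_notMem.2 fun s hs => ?_
    have hlt : t2 < s := by
      by_contra hle
      exact (eq_empty_iff_forall_notMem.1 he) s ⟨⟨hs.1.1, not_lt.1 hle⟩, hs.2⟩
    exact hlt.ne' (hiso s hs.2 ⟨by linarith, hs.1.2.le⟩)
  have hLip := hV.1 t1 (t2 + ε) (ht0.trans h1) hIoo
  set F : ℝ → Stt n := fun s => f s (x s) (u s) with hF
  have hint : IntegrableOn F (Icc t1 t2) := (hsol.flow t1 t2 h1 h12 h2 he).1
  have hInt : ∀ r s : ℝ, t1 ≤ r → r ≤ s → s ≤ t2 → IntervalIntegrable F volume r s :=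
    fun r s hr hrs hs => (intervalIntegrable_iff_integrableOn_Icc_of_le hrs).2
      (hint.mono_set (Icc_subset_Icc hr hs))
  have hx : ∀ s ∈ Icc t1 t2, x s = x t1 + ∫ r in t1..s, F r := fun s hs =>
    (hsol.flow t1 s h1 hs.1 (lt_of_le_of_lt (EReal.coe_le_coe_iff.2 hs.2) h2)
      (subset_eq_empty (inter_subset_inter_left _ (Ioc_subset_Ioc_right hs.2)) he)).2
  have hxc : ContinuousOn x (Icc t1 t2) := by
    have := intervalIntegral.continuousOn_primitive_interval (μ := volume) (f := F)
      (a := t1) (b := t2) (by rwa [uIcc_of_le h12])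
    rw [uIcc_of_le h12] at this
    exact (continuousOn_const.add this).congr hx
  have hGi : IntervalIntegrable (fun s => 1 + ‖F s‖) volume t1 t2 :=
    intervalIntegrable_const.add (hInt t1 t2 le_rfl h12 le_rfl).norm
  have hGac := hGi.absolutelyContinuousOnInterval_intervalIntegral (c := t1) left_mem_uIcc
  have hcompact : IsCompact ((fun s => (s, x s)) '' Icc t1 t2) :=
    isCompact_Icc.image_of_continuousOn (continuousOn_id.prodMk hxc)
  have hsub : (fun s => (s, x s)) '' Icc t1 t2 ⊆ Ico t1 (t2 + ε) ×ˢ (univ : Set (Stt n)) := by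
    rintro _ ⟨s, hs, rfl⟩
    exact ⟨⟨hs.1, by linarith [hs.2]⟩, mem_univ _⟩
  have hLip' : LocallyLipschitzOn ((fun s => (s, x s)) '' Icc t1 t2)
      fun q : ℝ × Stt n => V q.1 q.2 := by
    intro q hq
    obtain ⟨K, W, hW, hK⟩ := hLip q (hsub hq)
    exact ⟨K, W, nhdsWithin_mono _ hsub hW, hK⟩
  obtain ⟨K, hK⟩ := hLip'.exists_lipschitzOnWith_of_compact hcompact
  have hle : ∀ r ∈ Icc t1 t2, ∀ s ∈ Icc t1 t2, r ≤ s → dist (V r (x r)) (V s (x s)) ≤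
      K * dist (∫ q in t1..r, (1 + ‖F q‖)) (∫ q in t1..s, (1 + ‖F q‖)) := by
    intro r hr s hs hrs
    refine (hK.dist_le_mul _ ⟨r, hr, rfl⟩ _ ⟨s, hs, rfl⟩).trans
      (mul_le_mul_of_nonneg_left ?_ K.2)
    have hi := hInt r s hr.1 hrs hs.2
    have hd : (∫ q in t1..s, (1 + ‖F q‖)) - (∫ q in t1..r, (1 + ‖F q‖)) =
        (s - r) + ∫ q in r..s, ‖F q‖ := by
      rw [intervalIntegral.integral_interval_sub_left
        (hGi.mono_set (by rw [uIcc_of_le h12, uIcc_of_le hs.1]; exact Icc_subset_Icc_right hs.2))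
        (hGi.mono_set (by rw [uIcc_of_le h12, uIcc_of_le hr.1]; exact Icc_subset_Icc_right hr.2)),
        intervalIntegral.integral_add intervalIntegrable_const hi.norm]
      simp
    have hxd : dist (x r) (x s) ≤ ∫ q in r..s, ‖F q‖ := by
      rw [dist_comm, dist_eq_norm, hx r hr, hx s hs, add_sub_add_left_eq_sub,
        intervalIntegral.integral_interval_sub_left (hInt t1 s le_rfl hs.1 hs.2)
          (hInt t1 r le_rfl hr.1 hr.2)]
      exact intervalIntegral.norm_integral_le_integral_norm hrs
    have hpos : 0 ≤ ∫ q in r..s, ‖F q‖ := dist_nonneg.trans hxd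
    rw [dist_comm (∫ q in t1..r, (1 + ‖F q‖)), Real.dist_eq, hd, Prod.dist_eq]
    refine max_le ?_ ?_
    · rw [dist_comm, Real.dist_eq, abs_of_nonneg (sub_nonneg.2 hrs)]
      exact (le_add_of_nonneg_right hpos).trans (le_abs_self _)
    · exact (hxd.trans (le_add_of_nonneg_left (sub_nonneg.2 hrs))).trans (le_abs_self _)
  have hac : AbsolutelyContinuousOnInterval (fun s => V s (x s)) t1 t2 := by
    refine hGac.of_dist_le (K := K) fun r hr s hs => ?_
    rw [uIcc_of_le h12] at hr hs
    rcases le_total r s with hrs | hrs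
    · exact hle r hr s hs hrs
    · rw [dist_comm, dist_comm (∫ q in t1..r, (1 + ‖F q‖))]
      exact hle s hs r hr hrs
  refine ⟨hac, ?_⟩
  filter_upwards [hac.ae_differentiableAt,
    (hInt t1 t2 le_rfl h12 le_rfl).ae_hasDerivAt_integral] with s hs1 hs2 hs
  have hsI : s ∈ uIcc t1 t2 := by
    rw [uIcc_of_le h12]
    exact Ioo_subset_Icc_self hs
  have hder : HasDerivAt x (f s (x s) (u s)) s := by
    refine ((hs2 hsI t1 left_mem_uIcc).const_add (x t1)).congr_of_eventuallyEq ?_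
    filter_upwards [Ioo_mem_nhds hs.1 hs.2] with r hr
    exact hx r (Ioo_subset_Icc_self hr)
  exact diniAlong_eq_deriv ⟨hs.1.le, by linarith [hs.2]⟩ hLip hder (hs1 hsI)

lemma IsSolution.flowOn_comp (hsol : IsSolution γ f g t0 x0 u T x)
    (hγ : IsImpulseSeq γ) (hV : InClassV γ V Vm) (ht0 : 0 ≤ t0) {t1 t2 : ℝ} (h1 : t0 ≤ t1)
    (h12 : t1 ≤ t2) (h2 : (t2 : EReal) < T) (he : Ioc t1 t2 ∩ γ = ∅) {φ : ℝ → ℝ → ℝ}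
    (hdini : ∀ᵐ s ∂volume, s ∈ Ioo t1 t2 →
      DiniAlong f V s (x s) (u s) ≤ - φ s (V s (x s))) :
    FlowOn φ (fun s => V s (x s)) t1 t2 := by
  obtain ⟨hac, hder⟩ := hsol.absolutelyContinuous_comp hγ hV ht0 h1 h12 h2 he
  refine ⟨deriv fun s => V s (x s),
    (intervalIntegrable_iff_integrableOn_Icc_of_le h12).1 hac.intervalIntegrable_deriv, ?_,
    fun t ht => ?_⟩
  · have hn1 : ∀ᵐ s ∂volume, s ≠ t1 := by simp [ae_iff, measure_singleton]
    have hn2 : ∀ᵐ s ∂volume, s ≠ t2 := by simp [ae_iff, measure_singleton]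
    filter_upwards [hdini, hder, hn1, hn2] with s hs1 hs2 hs3 hs4 hs
    have hsI : s ∈ Ioo t1 t2 := ⟨lt_of_le_of_ne hs.1 hs3.symm, lt_of_le_of_ne hs.2 hs4⟩
    rw [← hs2 hsI]
    exact hs1 hsI
  · have hsub : uIcc t1 t ⊆ uIcc t1 t2 := by
      rw [uIcc_of_le h12, uIcc_of_le ht.1]
      exact Icc_subset_Icc_right ht.2
    rw [(hac.mono hsub).integral_deriv_eq_sub]
    ring

lemma IsSolution.tendsto_left_comp (hsol : IsSolution γ f g t0 x0 u T x)
    (hγ : IsImpulseSeq γ) (hV : InClassV γ V Vm) (ht0 : 0 ≤ t0) {τ : ℝ} (h0τ : t0 < τ)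
    (hτT : (τ : EReal) < T) (hτ : τ ∉ γ) :
    Tendsto (fun s => V s (x s)) (nhdsWithin τ (Iio τ)) (nhds (V τ (x τ))) := by
  obtain ⟨ε, hε, hiso⟩ := hγ.exists_isolated τ
  have hlt : max t0 (τ - ε) < τ := max_lt h0τ (by linarith)
  have he : Ioc (max t0 (τ - ε)) τ ∩ γ = ∅ := by
    refine eq_empty_iff_forall_notMem.2 fun s hs => ?_
    have h1 := (le_max_right t0 (τ - ε)).trans_lt hs.1.1
    exact hτ (hiso s hs.2 ⟨h1.le, by linarith [hs.1.2]⟩ ▸ hs.2)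
  have hc := (hsol.absolutelyContinuous_comp hγ hV ht0 (le_max_left _ _) hlt.le hτT
    he).1.continuousOn
  rw [uIcc_of_le hlt.le] at hc
  refine (hc τ ⟨hlt.le, le_rfl⟩).tendsto.mono_left (nhdsWithin_le_of_mem ?_)
  exact mem_of_superset (Ioo_mem_nhdsLT hlt) Ioo_subset_Icc_self

lemma InClassV.tendsto_left_comp (hV : InClassV γ V Vm) {τ : ℝ} (hτ : τ ∈ γ) {L : Stt n}
    (hL : Tendsto x (nhdsWithin τ (Iio τ)) (nhds L)) :
    Tendsto (fun s => V s (x s)) (nhdsWithin τ (Iio τ)) (nhds (Vm τ L)) := by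
  refine (hV.2 τ hτ L).comp (tendsto_nhdsWithin_iff.2
    ⟨(tendsto_id.mono_left nhdsWithin_le_nhds).prodMk_nhds hL, ?_⟩)
  filter_upwards [self_mem_nhdsWithin] with s hs
  exact ⟨hs, mem_univ _⟩

end Trajectory

section InputNorm

variable {m : ℕ} {γ : Set ℝ} {u : ℝ → Stt m} {t0 t : ℝ}

lemma inputNorm_nonneg (γ : Set ℝ) (u : ℝ → Stt m) (I : Set ℝ) : 0 ≤ inputNorm γ u I := by
  refine (Real.sSup_nonneg ?_).trans (le_max_right _ _)
  rintro _ ⟨s, _, rfl⟩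
  exact norm_nonneg _

lemma IsInput.ae_norm_le (hu : IsInput u) (γ : Set ℝ) (ht0 : 0 ≤ t0) (t : ℝ) :
    ∀ᵐ s ∂volume, s ∈ Ioc t0 t → ‖u s‖ ≤ inputNorm γ u (Ioc t0 t) := by
  obtain ⟨C, hC⟩ := hu.2 t
  have hbdd : IsBoundedUnder (· ≤ ·) (ae (volume.restrict (Ioc t0 t))) fun s => ‖u s‖ := by
    refine ⟨C, ?_⟩
    rw [eventually_map, ae_restrict_iff' measurableSet_Ioc]
    filter_upwards [hC] with s hs hsI
    exact hs ⟨ht0.trans hsI.1.le, hsI.2⟩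
  have := ae_le_essSup hbdd
  rw [ae_restrict_iff' measurableSet_Ioc] at this
  filter_upwards [this] with s hs hsI
  exact (hs hsI).trans (le_max_left _ _)

lemma IsImpulseSeq.norm_le_inputNorm (hγ : IsImpulseSeq γ) {s : ℝ} (hs : s ∈ γ)
    (hsI : s ∈ Ioc t0 t) : ‖u s‖ ≤ inputNorm γ u (Ioc t0 t) := by
  have hfin : (γ ∩ Ioc t0 t).Finite :=
    (hγ.2 t).subset (inter_subset_inter_right _ fun r hr => hr.2)
  exact (le_csSup (hfin.image fun r => ‖u r‖).bddAbove ⟨s, ⟨hs, hsI⟩, rfl⟩).trans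
    (le_max_right _ _)

end InputNorm

/-- Theorem 1 (strong case): if the comparison family is strongly GUAS then the
family of impulsive systems is strongly `(h⁰,h)`-ISS. -/
theorem stmt2 {n m : ℕ} {Λ : Type*} (γ : Λ → Set ℝ)
    (f g : Λ → ℝ → Stt n → Stt m → Stt n)
    (hγ : ∀ l : Λ, IsImpulseSeq (γ l))
    (h0 h : ℝ → Stt n → ℝ)
    (hh0 : ∀ (t : ℝ) (ξ : Stt n), 0 ≤ t → 0 ≤ h0 t ξ)
    (hh : ∀ (t : ℝ) (ξ : Stt n), 0 ≤ t → 0 ≤ h t ξ)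
    (V Vm : Λ → ℝ → Stt n → ℝ) (φ1 φ2 χ π : ℝ → ℝ)
    (vφ al : Λ → ℝ → ℝ → ℝ)
    (hA1 : Assumption1 γ f g h0 h V Vm φ1 φ2 χ π vφ al)
    (hGUAS : CompStrongGUAS γ vφ al) :
    StronglyISS γ f g h0 h := by
  obtain ⟨hφ1, hφ2, hχ, hπ, hV, hvφ, hal, hsandwich, hflow, hjump, hjump'⟩ := hA1
  obtain ⟨β, hβ, hB⟩ := hGUAS
  obtain ⟨ψ, hψ, hψφ⟩ := hφ1.exists_inverse
  refine ⟨fun r t => ψ (β (φ2 r) t),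
    fun r => ψ (β (max (max (χ r) (π r)) (β (χ r) 0)) 0), hβ.comp hψ hφ2,
    hψ.comp ((hβ.1 0 le_rfl).comp ((hχ.max hπ).max ((hβ.1 0 le_rfl).comp hχ))), ?_⟩
  intro l t0 x0 u T x ht0 hu hmax t htt htT
  have hsol := hmax.1
  set U := inputNorm (γ l) u (Ioc t0 t) with hU
  have hU0 : 0 ≤ U := inputNorm_nonneg _ _ _
  have hVnonneg : ∀ s, 0 ≤ s → ∀ ξ, 0 ≤ V l s ξ := fun s hs ξ =>
    (hφ1.nonneg (hh s ξ hs)).trans (hsandwich l s ξ hs).1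
  have hlt : ∀ s, s ≤ t → (s : EReal) < T := fun s hs =>
    lt_of_le_of_lt (EReal.coe_le_coe_iff.2 hs) htT
  have hbound := CompBound.le_of_threshold (hB l) hβ (hγ l) (hvφ l) (hal l)
    (t0 := t0) (t := t) (c := χ U) (p := π U) (v := fun s => V l s (x s))
    ht0 htt (fun s hs => hVnonneg s (ht0.trans hs.1) _)
    (fun t1 t2 h1 h12 h2 he hge => ?_)
    (fun τ hτ hτγ => hsol.tendsto_left_comp (hγ l) (hV l) ht0 hτ.1 (hlt τ hτ.2) hτγ)
    (fun τ hτ hτγ => ?_)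
  · have hx0 : V l t0 (x t0) ≤ φ2 (h0 t0 x0) := by
      rw [hsol.init]
      exact (hsandwich l t0 x0 ht0).2
    have hV0 := hVnonneg t0 ht0 (x t0)
    have htime : 0 ≤ t - t0 + (nJumps (γ l) t0 t : ℝ) :=
      add_nonneg (sub_nonneg.2 htt) (Nat.cast_nonneg _)
    have hφ20 := hφ2.nonneg (hh0 t0 x0 ht0)
    have hR0 : 0 ≤ max (max (χ U) (π U)) (β (χ U) 0) :=
      (hχ.nonneg hU0).trans ((le_max_left _ _).trans (le_max_left _ _))
    have ht := ht0.trans htt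
    have hA := hψ.nonneg (hβ.nonneg hφ20 htime)
    have hC := hψ.nonneg (hβ.nonneg hR0 le_rfl)
    have hφh := (hsandwich l t (x t) ht).1.trans hbound
    have hφh0 := hφ1.nonneg (hh t (x t) ht)
    rw [← hψφ _ (hh t (x t) ht)]
    rcases le_max_iff.1 hφh with hle | hle
    · exact (hψ.mono hφh0 (hle.trans ((hβ.1 _ htime).mono hV0 hx0))).trans
        (le_add_of_nonneg_right hC)
    · exact (hψ.mono hφh0 hle).trans (le_add_of_nonneg_left hA)
  · refine hsol.flowOn_comp (hγ l) (hV l) ht0 h1 h12 (hlt t2 h2) he ?_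
    filter_upwards [hu.ae_norm_le (γ l) ht0 t] with s hs hsI
    have hsIoc : s ∈ Ioc t1 t2 := Ioo_subset_Ioc_self hsI
    refine hflow l s (x s) (u s) (ht0.trans (h1.trans hsI.1.le))
      (fun hsγ => (eq_empty_iff_forall_notMem.1 he) s ⟨hsIoc, hsγ⟩) ?_
    exact (hχ.mono (norm_nonneg _) (hs ⟨h1.trans_lt hsI.1, hsI.2.le.trans h2⟩)).trans
      (hge s hsIoc)
  · obtain ⟨L, hL, hxτ⟩ := hsol.jump τ hτγ hτ.1 (hlt τ hτ.2)
    have hvL := (hV l).tendsto_left_comp hτγ hL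
    have huτ : ‖u τ‖ ≤ U := (hγ l).norm_le_inputNorm hτγ hτ
    refine ⟨Vm l τ L, ge_of_tendsto hvL ?_, hvL, fun hc => ?_, fun _ => ?_⟩
    · filter_upwards [Ioo_mem_nhdsLT hτ.1] with s hs
      exact hVnonneg s (ht0.trans hs.1.le) _
    · rw [hxτ]
      exact hjump l τ L (u τ) hτγ ((hχ.mono (norm_nonneg _) huτ).trans hc)
    · rw [hxτ]
      rcases le_total (χ ‖u τ‖) (Vm l τ L) with hc | hc
      · exact (hjump l τ L (u τ) hτγ hc).trans (le_max_right _ _)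
      · exact ((hjump' l τ L (u τ) hτγ hc).trans
          (hπ.mono (norm_nonneg _) huτ)).trans (le_max_left _ _)

end
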